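/- arXiv:0706.0192 — 3 statements merged into one kernel-verified Lean document; each statement's English description precedes it below -/
import Mathlib

section
/- Let $U$ be the entropy function on the interior $P^o$ of a polytope $P$ with $n$ vertices. For $x \in P^o$ and $\xi \ne 0$, let $d(x,\xi)$ denote the distance from $x$ to $\partial P$ along the ray $x + t\xi/|\xi|$, $t \ge 0$. Then $U_{(\xi)(\xi)}(x) \ge -(n + 4n^2) \, |\xi|^2 / \min(d(x,\xi), d(x,-\xi))^2$. -/
open Finset

/-- The entropy function of a polytope with vertices `a 1, …, a n`:
`U(x) = sup { ∑ᵢ ln pᵢ : pᵢ > 0, ∑ pᵢ = 1, ∑ pᵢ aᵢ = x }`. -/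
noncomputable def entropyU {d n : ℕ} (a : Fin n → EuclideanSpace ℝ (Fin d))
    (x : EuclideanSpace ℝ (Fin d)) : ℝ :=
  sSup {s | ∃ p : Fin n → ℝ, (∀ i, 0 < p i) ∧ ∑ i, p i = 1 ∧
    ∑ i, p i • a i = x ∧ s = ∑ i, Real.log (p i)}

/-- The distance from `x` to the boundary of `P` along the ray `x + t ξ/‖ξ‖`, `t ≥ 0`:
the supremum of those `t ≥ 0` for which the point of the ray at distance `t` is in `P`. -/
noncomputable def rayDist {d : ℕ} (P : Set (EuclideanSpace ℝ (Fin d)))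
    (x ξ : EuclideanSpace ℝ (Fin d)) : ℝ :=
  sSup {t : ℝ | 0 ≤ t ∧ x + (t * ‖ξ‖⁻¹) • ξ ∈ P}

/-- feasible nonneg weights -/
lemma aux_mem_hull {d n : ℕ} (a : Fin n → EuclideanSpace ℝ (Fin d))
    (y : EuclideanSpace ℝ (Fin d)) (hy : y ∈ convexHull ℝ (Set.range a)) :
    ∃ r : Fin n → ℝ, (∀ i, 0 ≤ r i) ∧ ∑ i, r i = 1 ∧ ∑ i, r i • a i = y := by
  rw [convexHull_range_eq_exists_affineCombination] at hy
  obtain ⟨s, w, h0, h1, h2⟩ := hy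
  rw [Finset.affineCombination_eq_linear_combination _ _ _ h1] at h2
  refine ⟨fun i => if i ∈ s then w i else 0, ?_, ?_, ?_⟩
  · intro i
    by_cases h : i ∈ s
    · simp [h, h0 i h]
    · simp [h]
  · simpa using h1
  · simpa [ite_smul] using h2

/-- p maximizes the entropy at y -/
def MaxAt {d n : ℕ} (a : Fin n → EuclideanSpace ℝ (Fin d)) (y : EuclideanSpace ℝ (Fin d))
    (p : Fin n → ℝ) : Prop :=
  (∀ i, 0 < p i) ∧ ∑ i, p i = 1 ∧ ∑ i, p i • a i = y ∧
    ∀ p' : Fin n → ℝ, (∀ i, 0 < p' i) → ∑ i, p' i = 1 → ∑ i, p' i • a i = y →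
      ∑ i, Real.log (p' i) ≤ ∑ i, Real.log (p i)

lemma aux_pos {d n : ℕ} (hn : 2 ≤ n) (a : Fin n → EuclideanSpace ℝ (Fin d))
    (y : EuclideanSpace ℝ (Fin d)) (hy : y ∈ interior (convexHull ℝ (Set.range a))) :
    ∃ r : Fin n → ℝ, (∀ i, 0 < r i) ∧ ∑ i, r i = 1 ∧ ∑ i, r i • a i = y := by
  set c : EuclideanSpace ℝ (Fin d) := ∑ i, (1 / (n : ℝ)) • a i with hc
  have hn0 : (0 : ℝ) < n := by positivity
  have hcont : ContinuousAt (fun e : ℝ => y + e • (y - c)) 0 := by fun_prop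
  have hev : ∀ᶠ e in nhds (0 : ℝ), y + e • (y - c) ∈ convexHull ℝ (Set.range a) := by
    apply hcont.eventually_mem
    simpa using mem_interior_iff_mem_nhds.1 hy
  obtain ⟨δ, hδ, h⟩ := Metric.eventually_nhds_iff.1 hev
  have h1 := h (y := δ / 2) (by simp [abs_of_pos hδ]; linarith)
  set e := δ / 2
  have he : 0 < e := by positivity
  obtain ⟨r, hr0, hr1, hr2⟩ := aux_mem_hull a _ h1
  refine ⟨fun i => (1 + e)⁻¹ * (r i + e * (1 / n)), ?_, ?_, ?_⟩
  · intro i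
    have := hr0 i
    positivity
  · rw [← Finset.mul_sum, Finset.sum_add_distrib, hr1]
    simp
    field_simp
  · simp only [mul_smul, add_smul, ← Finset.smul_sum, Finset.sum_add_distrib, hr2]
    have : (1 / (n : ℝ)) • ∑ x, a x = c := by rw [hc, Finset.smul_sum]
    rw [this, smul_sub]
    have : y + (e • y - e • c) + e • c = (1 + e) • y := by module
    rw [this, smul_smul, inv_mul_cancel₀ (by positivity), one_smul]

lemma aux_max {d n : ℕ} (hn : 2 ≤ n) (a : Fin n → EuclideanSpace ℝ (Fin d))
    (y : EuclideanSpace ℝ (Fin d)) (hy : y ∈ interior (convexHull ℝ (Set.range a))) :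
    ∃ p, MaxAt a y p := by
  obtain ⟨r, hr0, hr1, hr2⟩ := aux_pos hn a y hy
  let K : Set (Fin n → ℝ) := stdSimplex ℝ (Fin n) ∩ {p | ∑ i, p i • a i = y}
  have hK : IsCompact K := by
    apply (isCompact_stdSimplex ℝ (Fin n)).inter_right
    exact isClosed_eq (by fun_prop) continuous_const
  have hrK : r ∈ K := ⟨⟨fun i => (hr0 i).le, hr1⟩, hr2⟩
  obtain ⟨p, hpK, hmax⟩ := hK.exists_isMaxOn ⟨r, hrK⟩
    (f := fun p : Fin n → ℝ => ∏ i, p i) (by fun_prop)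
  have hpp : 0 < ∏ i, p i := lt_of_lt_of_le (Finset.prod_pos fun i _ => hr0 i) (hmax hrK)
  have hp0 : ∀ i, 0 < p i := fun i =>
    lt_of_le_of_ne (hpK.1.1 i) fun h => by
      rw [Finset.prod_eq_zero (Finset.mem_univ i) h.symm] at hpp
      exact lt_irrefl _ hpp
  refine ⟨p, hp0, hpK.1.2, hpK.2, ?_⟩
  intro p' h0 h1 h2
  rw [← Real.log_prod (fun i _ => (h0 i).ne'), ← Real.log_prod (fun i _ => (hp0 i).ne')]
  exact Real.log_le_log (Finset.prod_pos fun i _ => h0 i)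
    (hmax (show p' ∈ K from ⟨⟨fun i => (h0 i).le, h1⟩, h2⟩))

lemma aux_bdd {d n : ℕ} (a : Fin n → EuclideanSpace ℝ (Fin d)) (y : EuclideanSpace ℝ (Fin d)) :
    BddAbove {s | ∃ p : Fin n → ℝ, (∀ i, 0 < p i) ∧ ∑ i, p i = 1 ∧
      ∑ i, p i • a i = y ∧ s = ∑ i, Real.log (p i)} := by
  refine ⟨0, ?_⟩
  rintro s ⟨p, h0, h1, -, rfl⟩
  refine Finset.sum_nonpos fun i _ => Real.log_nonpos (h0 i).le ?_
  rw [← h1]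
  exact Finset.single_le_sum (fun j _ => (h0 j).le) (Finset.mem_univ i)

lemma aux_le {d n : ℕ} (a : Fin n → EuclideanSpace ℝ (Fin d)) (y : EuclideanSpace ℝ (Fin d))
    (p : Fin n → ℝ) (h0 : ∀ i, 0 < p i) (h1 : ∑ i, p i = 1) (h2 : ∑ i, p i • a i = y) :
    ∑ i, Real.log (p i) ≤ entropyU a y :=
  le_csSup (aux_bdd a y) ⟨p, h0, h1, h2, rfl⟩

lemma MaxAt.eq {d n : ℕ} {a : Fin n → EuclideanSpace ℝ (Fin d)} {y : EuclideanSpace ℝ (Fin d)}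
    {p : Fin n → ℝ} (h : MaxAt a y p) : entropyU a y = ∑ i, Real.log (p i) := by
  apply le_antisymm
  · refine csSup_le ⟨∑ i, Real.log (p i), p, h.1, h.2.1, h.2.2.1, rfl⟩ ?_
    rintro s ⟨p', h0, h1, h2, rfl⟩
    exact h.2.2.2 p' h0 h1 h2
  · exact aux_le a y p h.1 h.2.1 h.2.2.1

lemma aux_ev {n : ℕ} (p q : Fin n → ℝ) (hp : ∀ i, 0 < p i) :
    ∀ᶠ t in nhds (0 : ℝ), ∀ i, 0 < p i + t * q i := by
  rw [Filter.eventually_all]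
  intro i
  have : ContinuousAt (fun t : ℝ => p i + t * q i) 0 := by fun_prop
  exact this.eventually (lt_mem_nhds (by simpa using hp i))

lemma aux_deriv {n : ℕ} (p q : Fin n → ℝ) (t : ℝ) (hp : ∀ i, 0 < p i + t * q i) :
    HasDerivAt (fun t : ℝ => ∑ i, Real.log (p i + t * q i)) (∑ i, q i / (p i + t * q i)) t := by
  apply HasDerivAt.fun_sum
  intro i _
  have e : HasDerivAt (fun t : ℝ => p i + t * q i) (q i) t := by
    simpa using ((hasDerivAt_id t).mul_const (q i)).const_add (p i)
  exact e.log (hp i).ne'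

lemma MaxAt.ker {d n : ℕ} {a : Fin n → EuclideanSpace ℝ (Fin d)} {y : EuclideanSpace ℝ (Fin d)}
    {p : Fin n → ℝ} (h : MaxAt a y p) (q : Fin n → ℝ) (h1 : ∑ i, q i = 0)
    (h2 : ∑ i, q i • a i = 0) : ∑ i, q i / p i = 0 := by
  have hm : IsLocalMax (fun t : ℝ => ∑ i, Real.log (p i + t * q i)) 0 := by
    filter_upwards [aux_ev p q h.1] with t ht
    simp only [zero_mul, add_zero]
    apply h.2.2.2 _ ht
    · rw [Finset.sum_add_distrib, ← Finset.mul_sum, h1, h.2.1]; simp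
    · simp only [add_smul, mul_smul, Finset.sum_add_distrib, ← Finset.smul_sum, h2, h.2.2.1]; simp
  have hd := aux_deriv p q 0 (by simpa using h.1)
  simpa using hm.hasDerivAt_eq_zero hd

lemma aux_L {d n : ℕ} (a : Fin n → EuclideanSpace ℝ (Fin d))
    (x : EuclideanSpace ℝ (Fin d)) (hx : x ∈ interior (convexHull ℝ (Set.range a))) :
    ∃ L : EuclideanSpace ℝ (Fin d) →L[ℝ] (Fin n → ℝ), ∀ v, ∑ i, L v i = 0 ∧
      ∑ i, L v i • a i = v := by
  let T : (Fin n → ℝ) →ₗ[ℝ] ℝ × EuclideanSpace ℝ (Fin d) :=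
    { toFun := fun q => (∑ i, q i, ∑ i, q i • a i)
      map_add' := fun q r => by simp [add_smul, Finset.sum_add_distrib]
      map_smul' := fun c q => by simp [mul_smul, Finset.smul_sum, Finset.mul_sum] }
  obtain ⟨r0, -, h01, h02⟩ := aux_mem_hull a x (interior_subset hx)
  have key : ∀ v, ∃ q, T q = (0, v) := by
    intro v
    have hcont : ContinuousAt (fun e : ℝ => x + e • v) 0 := by fun_prop
    have hev : ∀ᶠ e in nhds (0 : ℝ), x + e • v ∈ convexHull ℝ (Set.range a) := by
      apply hcont.eventually_mem
      simpa using mem_interior_iff_mem_nhds.1 hx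
    obtain ⟨δ, hδ, h⟩ := Metric.eventually_nhds_iff.1 hev
    have h1 := h (y := δ / 2) (by simp [abs_of_pos hδ]; linarith)
    obtain ⟨r, -, hr1, hr2⟩ := aux_mem_hull a _ h1
    refine ⟨(δ / 2)⁻¹ • (r - r0), ?_⟩
    rw [map_smul, map_sub]
    have e1 : T r = (1, x + (δ / 2) • v) := Prod.ext hr1 hr2
    have e2 : T r0 = (1, x) := Prod.ext h01 h02
    rw [e1, e2]
    have : (δ / 2) ≠ 0 := by positivity
    ext1
    · simp
    · simp only [Prod.mk_sub_mk, add_sub_cancel_left, Prod.smul_mk]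
      rw [smul_smul, inv_mul_cancel₀ this, one_smul]
  have hsurj : LinearMap.range T = ⊤ := by
    rw [LinearMap.range_eq_top]
    rintro ⟨c, v⟩
    obtain ⟨q, hq⟩ := key (v - c • x)
    have e2 : T r0 = (1, x) := Prod.ext h01 h02
    refine ⟨q + c • r0, ?_⟩
    rw [map_add, map_smul, hq, e2]
    simp
  obtain ⟨R, hR⟩ := T.exists_rightInverse_of_surjective hsurj
  refine ⟨LinearMap.toContinuousLinearMap (R ∘ₗ LinearMap.inr ℝ ℝ _), fun v => ?_⟩
  have := LinearMap.congr_fun hR (0, v)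
  exact ⟨congrArg Prod.fst this, congrArg Prod.snd this⟩

lemma aux_diff {d n : ℕ} (hn : 2 ≤ n) (a : Fin n → EuclideanSpace ℝ (Fin d))
    (y : EuclideanSpace ℝ (Fin d)) (hy : y ∈ interior (convexHull ℝ (Set.range a))) :
    DifferentiableAt ℝ (entropyU a) y := by
  obtain ⟨p, hp⟩ := aux_max hn a y hy
  obtain ⟨L, hL⟩ := aux_L a y hy
  let f' : EuclideanSpace ℝ (Fin d) →L[ℝ] ℝ :=
    ∑ i, (p i)⁻¹ • (ContinuousLinearMap.proj i ∘L L)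
  let ψ : EuclideanSpace ℝ (Fin d) → ℝ := fun z => ∑ i, Real.log (p i + L (z - y) i)
  have hψy : ψ y = entropyU a y := by simp [ψ, hp.eq]
  have hψ : HasFDerivAt ψ f' y := by
    apply HasFDerivAt.fun_sum
    intro i _
    have h1 : HasFDerivAt (fun z => p i + L (z - y) i) (ContinuousLinearMap.proj i ∘L L) y := by
      have : HasFDerivAt (fun z => (ContinuousLinearMap.proj (R := ℝ) (φ := fun _ => ℝ) i ∘L L) (z - y)) (ContinuousLinearMap.proj (R := ℝ) (φ := fun _ => ℝ) i ∘L L) y := by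
        exact (ContinuousLinearMap.proj (R := ℝ) (φ := fun _ => ℝ) i ∘L L).hasFDerivAt.comp y ((hasFDerivAt_id y).sub_const y)
      exact this.const_add (p i)
    have := h1.log (by simpa using (hp.1 i).ne')
    simpa using this
  have hev : ∀ᶠ z in nhds y, ∀ i, 0 < p i + L (z - y) i := by
    rw [Filter.eventually_all]
    intro i
    have : ContinuousAt (fun z => p i + L (z - y) i) y := by fun_prop
    exact this.eventually (lt_mem_nhds (by simpa using hp.1 i))
  have hf' : ∀ v, f' v = ∑ i, L v i / p i := by
    intro v
    simp [f', div_eq_inv_mul]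
  have hlow : ∀ᶠ z in nhds y, ψ z ≤ entropyU a z ∧ entropyU a z ≤ entropyU a y + f' (z - y) := by
    filter_upwards [hev] with z hz
    have g1 : ∑ i, (p i + L (z - y) i) = 1 := by
      rw [Finset.sum_add_distrib, hp.2.1, (hL _).1, add_zero]
    have g2 : ∑ i, (p i + L (z - y) i) • a i = z := by
      simp only [add_smul, Finset.sum_add_distrib, hp.2.2.1, (hL _).2]
      abel
    refine ⟨aux_le a z _ hz g1 g2, ?_⟩
    refine csSup_le ⟨∑ i, Real.log (p i + L (z - y) i), _, hz, g1, g2, rfl⟩ ?_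
    rintro s ⟨p', h0, h1, h2, rfl⟩
    have hk := hp.ker (fun i => p' i - p i - L (z - y) i)
      (by simp [Finset.sum_sub_distrib, h1, hp.2.1, (hL _).1])
      (by simp [sub_smul, Finset.sum_sub_distrib, h2, hp.2.2.1, (hL _).2])
    have hk' : f' (z - y) = ∑ i, (p' i / p i - 1) := by
      rw [hf', eq_comm, ← sub_eq_zero, ← Finset.sum_sub_distrib, ← hk]
      refine Finset.sum_congr rfl fun i _ => ?_
      have := (hp.1 i).ne'
      field_simp
    rw [hk', hp.eq, ← Finset.sum_add_distrib]
    refine Finset.sum_le_sum fun i _ => ?_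
    have := Real.log_le_sub_one_of_pos (div_pos (h0 i) (hp.1 i))
    rw [Real.log_div (h0 i).ne' (hp.1 i).ne'] at this
    linarith
  refine HasFDerivAt.differentiableAt (f' := f') ?_
  rw [hasFDerivAt_iff_isLittleO] at hψ ⊢
  refine Asymptotics.IsBigO.trans_isLittleO ?_ hψ
  refine Asymptotics.IsBigO.of_bound 1 ?_
  filter_upwards [hlow] with z hz
  rw [hψy, Real.norm_eq_abs, Real.norm_eq_abs, abs_of_nonpos (by linarith [hz.2]), abs_of_nonpos (by linarith [hz.1, hz.2])]
  linarith [hz.1]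

lemma aux_second {d n : ℕ} (hn : 2 ≤ n) (a : Fin n → EuclideanSpace ℝ (Fin d))
    (x : EuclideanSpace ℝ (Fin d)) (hx : x ∈ interior (convexHull ℝ (Set.range a)))
    (ξ : EuclideanSpace ℝ (Fin d)) (p : Fin n → ℝ) (hp : MaxAt a x p) (q : Fin n → ℝ)
    (h1 : ∑ i, q i = 0) (h2 : ∑ i, q i • a i = ξ) :
    -∑ i, (q i / p i) ^ 2 ≤ fderiv ℝ (fun y => fderiv ℝ (entropyU a) y ξ) x ξ := by
  by_cases hd : DifferentiableAt ℝ (fun y => fderiv ℝ (entropyU a) y ξ) x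
  swap
  · rw [fderiv_zero_of_not_differentiableAt hd]
    simp only [zero_apply, Left.neg_nonpos_iff]
    positivity
  set g := fun y => fderiv ℝ (entropyU a) y ξ with hg
  let χ : ℝ → ℝ := fun t => entropyU a (x + t • ξ) - ∑ i, Real.log (p i + t * q i)
  have hline : ∀ t : ℝ, HasDerivAt (fun t : ℝ => x + t • ξ) ξ t := fun t => by
    simpa using ((hasDerivAt_id t).smul_const ξ).const_add x
  have hint : ∀ᶠ t in nhds (0 : ℝ), x + t • ξ ∈ interior (convexHull ℝ (Set.range a)) := by
    apply (hline 0).continuousAt.eventually_mem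
    simpa using isOpen_interior.mem_nhds hx
  have hχ0 : χ 0 = 0 := by simp [χ, hp.eq]
  have hmin : IsLocalMin χ 0 := by
    filter_upwards [aux_ev p q hp.1] with t ht
    rw [hχ0]
    refine sub_nonneg.2 (aux_le a _ _ ht ?_ ?_)
    · rw [Finset.sum_add_distrib, ← Finset.mul_sum, h1, hp.2.1]; simp
    · simp only [add_smul, mul_smul, Finset.sum_add_distrib, ← Finset.smul_sum, h2, hp.2.2.1]
  have hder : ∀ᶠ t in nhds (0 : ℝ),
      HasDerivAt χ (g (x + t • ξ) - ∑ i, q i / (p i + t * q i)) t := by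
    filter_upwards [aux_ev p q hp.1, hint] with t ht hi
    exact ((aux_diff hn a _ hi).hasFDerivAt.comp_hasDerivAt t (hline t)).sub (aux_deriv p q t ht)
  have hder' : deriv χ =ᶠ[nhds 0] fun t => g (x + t • ξ) - ∑ i, q i / (p i + t * q i) :=
    hder.mono fun t ht => ht.deriv
  have hdd : HasDerivAt (fun t => g (x + t • ξ) - ∑ i, q i / (p i + t * q i))
      (fderiv ℝ g x ξ - ∑ i, -(q i / p i) ^ 2) 0 := by
    apply HasDerivAt.sub
    · have : HasFDerivAt g (fderiv ℝ g x) (x + (0 : ℝ) • ξ) := by simpa using hd.hasFDerivAt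
      exact this.comp_hasDerivAt 0 (hline 0)
    · apply HasDerivAt.fun_sum
      intro i _
      have hi := (hp.1 i).ne'
      have e : HasDerivAt (fun t : ℝ => p i + t * q i) (q i) 0 := by
        simpa using ((hasDerivAt_id (0 : ℝ)).mul_const (q i)).const_add (p i)
      have := (hasDerivAt_const (0 : ℝ) (q i)).div e (by simpa using hi)
      refine HasDerivAt.congr_deriv this ?_
      simp
      field_simp
  have hD : deriv (deriv χ) 0 = fderiv ℝ g x ξ - ∑ i, -(q i / p i) ^ 2 := by
    rw [hder'.deriv_eq]; exact hdd.deriv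
  by_contra hcon
  push Not at hcon
  have hneg : deriv (deriv χ) 0 < 0 := by
    rw [hD, Finset.sum_neg_distrib]; linarith
  have hmax := isLocalMax_of_deriv_deriv_neg hneg hmin.deriv_eq_zero
    hder.self_of_nhds.continuousAt
  have hconst : χ =ᶠ[nhds 0] fun _ => χ 0 := by
    filter_upwards [hmin, hmax] with t h1 h2 using le_antisymm h2 h1
  have : deriv χ =ᶠ[nhds 0] fun _ => 0 := by
    have := hconst.deriv
    simpa using this
  rw [this.deriv_eq] at hneg
  simp at hneg

lemma aux_ray {d n : ℕ} (a : Fin n → EuclideanSpace ℝ (Fin d))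
    (x : EuclideanSpace ℝ (Fin d)) (hx : x ∈ interior (convexHull ℝ (Set.range a)))
    (ξ : EuclideanSpace ℝ (Fin d)) (hξ : ξ ≠ 0) :
    0 < rayDist (convexHull ℝ (Set.range a)) x ξ ∧
      ∀ s, 0 ≤ s → s < rayDist (convexHull ℝ (Set.range a)) x ξ →
        x + (s * ‖ξ‖⁻¹) • ξ ∈ convexHull ℝ (Set.range a) := by
  have hξ' : 0 < ‖ξ‖ := norm_pos_iff.2 hξ
  have hxP := interior_subset hx
  constructor
  · have hcont : ContinuousAt (fun e : ℝ => x + (e * ‖ξ‖⁻¹) • ξ) 0 := by fun_prop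
    have hev : ∀ᶠ e in nhds (0 : ℝ), x + (e * ‖ξ‖⁻¹) • ξ ∈ convexHull ℝ (Set.range a) := by
      apply hcont.eventually_mem
      simpa using mem_interior_iff_mem_nhds.1 hx
    obtain ⟨δ, hδ, h⟩ := Metric.eventually_nhds_iff.1 hev
    have h1 := h (y := δ / 2) (by simp [abs_of_pos hδ]; linarith)
    refine lt_of_lt_of_le (half_pos hδ) (le_csSup ?_ ⟨(half_pos hδ).le, h1⟩)
    have hb : Bornology.IsBounded (convexHull ℝ (Set.range a)) :=
      isBounded_convexHull.2 (Set.finite_range a).isBounded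
    obtain ⟨C, hC⟩ := Metric.isBounded_iff.1 hb
    refine ⟨C, ?_⟩
    rintro t ⟨ht, htP⟩
    have := hC htP hxP
    rw [dist_eq_norm, add_sub_cancel_left, norm_smul, Real.norm_eq_abs,
      abs_of_nonneg (by positivity), mul_assoc, inv_mul_cancel₀ hξ'.ne', mul_one] at this
    exact this
  · intro s hs hlt
    obtain ⟨t, ⟨ht, htP⟩, hst⟩ := exists_lt_of_lt_csSup
      (s := {t : ℝ | 0 ≤ t ∧ x + (t * ‖ξ‖⁻¹) • ξ ∈ convexHull ℝ (Set.range a)})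
      ⟨0, le_rfl, by simpa using hxP⟩ hlt
    have ht0 : 0 < t := lt_of_le_of_lt hs hst
    have := (convex_convexHull ℝ (Set.range a)).add_smul_mem hxP htP
      (t := s / t) ⟨by positivity, (div_le_one ht0).2 hst.le⟩
    rw [smul_smul] at this
    convert this using 3
    field_simp

/-- Hessian lower bound for the entropy function:
`U_{(ξ)(ξ)}(x) ≥ -(n + 4n²) |ξ|² / min(d(x,ξ), d(x,-ξ))²`. -/
theorem stmt_15 {d n : ℕ} (hn : 2 ≤ n) (a : Fin n → EuclideanSpace ℝ (Fin d))
    (ha : Function.Injective a)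
    (P : Set (EuclideanSpace ℝ (Fin d)))
    (hP : P = convexHull ℝ (Set.range a))
    (hvert : ∀ i, a i ∈ Set.extremePoints ℝ P)
    (hint : (interior P).Nonempty) :
    ∀ x ∈ interior P, ∀ ξ : EuclideanSpace ℝ (Fin d), ξ ≠ 0 →
      fderiv ℝ (fun y => fderiv ℝ (entropyU a) y ξ) x ξ
        ≥ -((n : ℝ) + 4 * (n : ℝ) ^ 2) * ‖ξ‖ ^ 2
            / (min (rayDist P x ξ) (rayDist P x (-ξ))) ^ 2 := by
  subst hP
  intro x hx ξ hξ
  obtain ⟨hD1, hr1⟩ := aux_ray a x hx ξ hξ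
  obtain ⟨hD2, hr2⟩ := aux_ray a x hx (-ξ) (neg_ne_zero.2 hξ)
  set m := min (rayDist (convexHull ℝ (Set.range a)) x ξ)
    (rayDist (convexHull ℝ (Set.range a)) x (-ξ)) with hm
  have hm0 : 0 < m := lt_min hD1 hD2
  have hξ' : 0 < ‖ξ‖ := norm_pos_iff.2 hξ
  obtain ⟨r, hr0, hrs, hra⟩ := aux_mem_hull a _
    (hr1 (m / 2) (by positivity) (lt_of_lt_of_le (half_lt_self hm0) (min_le_left _ _)))
  obtain ⟨r', hr0', hrs', hra'⟩ := aux_mem_hull a _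
    (hr2 (m / 2) (by positivity) (lt_of_lt_of_le (half_lt_self hm0) (min_le_right _ _)))
  rw [norm_neg] at hra'
  obtain ⟨p, hp⟩ := aux_max hn a x hx
  have hk := hp.ker (fun i => r i + r' i - 2 * p i)
    (by simp only [Finset.sum_sub_distrib, Finset.sum_add_distrib, ← Finset.mul_sum,
          hrs, hrs', hp.2.1]; norm_num)
    (by simp only [sub_smul, add_smul, mul_smul, Finset.sum_sub_distrib, Finset.sum_add_distrib,
          ← Finset.smul_sum, hra, hra', hp.2.2.1]; module)
  have hk2 : ∑ i, (r i + r' i) / p i = 2 * n := by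
    have : ∑ i, (r i + r' i - 2 * p i) / p i = ∑ i, ((r i + r' i) / p i - 2) := by
      refine Finset.sum_congr rfl fun i _ => ?_
      have := (hp.1 i).ne'
      field_simp
    rw [this, Finset.sum_sub_distrib] at hk
    simp at hk
    linarith
  have key := aux_second hn a x hx ξ p hp (fun i => (‖ξ‖ / m) * (r i - r' i))
    (by rw [← Finset.mul_sum, Finset.sum_sub_distrib, hrs, hrs']; simp)
    (by
      simp only [mul_smul, sub_smul, Finset.sum_sub_distrib, ← Finset.smul_sum]
      rw [hra, hra']
      have : (x + (m / 2 * ‖ξ‖⁻¹) • ξ - (x + (m / 2 * ‖ξ‖⁻¹) • -ξ)) = (m * ‖ξ‖⁻¹) • ξ := by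
        module
      rw [this, smul_smul]
      have : ‖ξ‖ / m * (m * ‖ξ‖⁻¹) = 1 := by field_simp
      rw [this, one_smul])
  refine le_trans ?_ key
  have hsq : ∑ i, ((r i + r' i) / p i) ^ 2 ≤ (2 * n : ℝ) ^ 2 := by
    rw [← hk2]
    apply Finset.sum_sq_le_sq_sum_of_nonneg
    intro i _
    exact div_nonneg (add_nonneg (hr0 i) (hr0' i)) (hp.1 i).le
  have hle : ∑ i, ((‖ξ‖ / m) * (r i - r' i) / p i) ^ 2 ≤ (‖ξ‖ / m) ^ 2 * (2 * n : ℝ) ^ 2 := by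
    refine le_trans ?_ (mul_le_mul_of_nonneg_left hsq (by positivity))
    rw [Finset.mul_sum]
    refine Finset.sum_le_sum fun i _ => ?_
    rw [mul_div_assoc, mul_pow, div_pow (r i - r' i), div_pow (r i + r' i)]
    gcongr ?_ * (?_ / _)
    nlinarith [mul_nonneg (hr0 i) (hr0' i)]
  have : -((n : ℝ) + 4 * (n : ℝ) ^ 2) * ‖ξ‖ ^ 2 / m ^ 2
      = -((‖ξ‖ / m) ^ 2 * (2 * n : ℝ) ^ 2) - n * (‖ξ‖ / m) ^ 2 := by
    rw [div_pow]; ring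
  rw [this]
  have : 0 ≤ n * (‖ξ‖ / m) ^ 2 := by positivity
  linarith
end

section
/- For the entropy-maximizing weights $p_k$ on the interior of a polytope $P$ with $n$ vertices: for every interior point $x$, direction $\xi\ne 0$, and index $k$, $|p_{k(\xi)}(x)| / p_k(x) \le (n+4n^2)^{1/2} \, |\xi| / \min(d(x,\xi), d(x,-\xi))$, where $d(x,\pm\xi)$ is the distance from $x$ to $\partial P$ along the ray in direction $\pm\xi$. -/
open Finset

open Filter Topology in
lemma opt_aux {d n : ℕ} (a : Fin n → EuclideanSpace ℝ (Fin d)) (x : EuclideanSpace ℝ (Fin d))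
    (p : Fin n → ℝ) (hp : ∀ i, 0 < p i) (h1 : ∑ i, p i = 1) (h2 : ∑ i, p i • a i = x)
    (h3 : ∑ i, Real.log (p i) = entropyU a x)
    (v : Fin n → ℝ) (hv1 : ∑ i, v i = 0) (hv2 : ∑ i, v i • a i = 0) :
    ∑ i, v i / p i = 0 := by
  have hbdd : BddAbove {s | ∃ p : Fin n → ℝ, (∀ i, 0 < p i) ∧ ∑ i, p i = 1 ∧
    ∑ i, p i • a i = x ∧ s = ∑ i, Real.log (p i)} := by
    refine ⟨0, ?_⟩
    rintro s ⟨q, hq, hq1, -, rfl⟩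
    apply Finset.sum_nonpos
    intro i _
    apply Real.log_nonpos (hq i).le
    rw [← hq1]
    exact Finset.single_le_sum (fun j _ => (hq j).le) (Finset.mem_univ i)
  have hev : ∀ᶠ e : ℝ in 𝓝 0, ∀ i, 0 < p i + e * v i := by
    rw [eventually_all]
    intro i
    have : Tendsto (fun e : ℝ => p i + e * v i) (𝓝 0) (𝓝 (p i + 0 * v i)) :=
      Continuous.tendsto (by fun_prop) 0
    apply this.eventually_const_lt
    simpa using hp i
  have hmax : IsLocalMax (fun e : ℝ => ∑ i, Real.log (p i + e * v i)) 0 := by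
    filter_upwards [hev] with e he
    simp only [zero_mul, add_zero]
    rw [h3]
    apply le_csSup hbdd
    refine ⟨fun i => p i + e * v i, he, ?_, ?_, rfl⟩
    · rw [Finset.sum_add_distrib, ← Finset.mul_sum, hv1, h1]; simp
    · simp only [add_smul, mul_smul]
      rw [Finset.sum_add_distrib, ← Finset.smul_sum, hv2, h2]; simp
  have hd : HasDerivAt (fun e : ℝ => ∑ i, Real.log (p i + e * v i)) (∑ i, v i / p i) 0 := by
    apply HasDerivAt.fun_sum
    intro i _
    have h : HasDerivAt (fun e : ℝ => p i + e * v i) (v i) 0 := by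
      simpa using ((hasDerivAt_id (0:ℝ)).mul_const (v i)).const_add (p i)
    have := h.log (by simpa using (hp i).ne')
    simpa using this
  exact hmax.hasDerivAt_eq_zero hd

lemma diff_aux {n : ℕ} (p q w : Fin n → ℝ) (t : ℝ) (hp : ∀ i, 0 < p i) (hq : ∀ i, 0 < q i)
    (h1 : ∑ i, (q i - p i - t * w i) / p i = 0) (h2 : ∑ i, (q i - p i - t * w i) / q i = 0) :
    ∑ i, (q i - p i) ^ 2 / (p i * q i) ≤ t ^ 2 * ∑ i, w i ^ 2 / (p i * q i) := by
  have key : ∑ i, ((q i - p i) ^ 2 / (p i * q i) - t * (w i * (q i - p i) / (p i * q i))) = 0 := by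
    rw [← sub_zero (0:ℝ)]
    nth_rw 1 [← h1]
    rw [← h2, ← Finset.sum_sub_distrib]
    apply Finset.sum_congr rfl
    intro i _
    have := (hp i).ne'
    have := (hq i).ne'
    field_simp
  -- use 2ab ≤ a²+b²
  have hle : ∑ i, (q i - p i) ^ 2 / (p i * q i) - t ^ 2 * ∑ i, w i ^ 2 / (p i * q i)
      ≤ 2 * ∑ i, ((q i - p i) ^ 2 / (p i * q i) - t * (w i * (q i - p i) / (p i * q i))) := by
    rw [Finset.mul_sum, Finset.mul_sum, ← Finset.sum_sub_distrib]
    apply Finset.sum_le_sum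
    intro i _
    have : 0 ≤ (q i - p i - t * w i) ^ 2 / (p i * q i) := by
      have := hp i; have := hq i; positivity
    have e : (q i - p i - t * w i) ^ 2 / (p i * q i) = (q i - p i) ^ 2 / (p i * q i)
      - 2 * (t * (w i * (q i - p i) / (p i * q i))) + t ^ 2 * (w i ^ 2 / (p i * q i)) := by
      ring
    linarith
  rw [key] at hle
  linarith

open Filter Topology in
lemma lim_aux {n : ℕ} (p w : Fin n → ℝ) (q : ℝ → Fin n → ℝ) (hp : ∀ i, 0 < p i)
    (hq : ∀ᶠ t in 𝓝[≠] (0:ℝ), (∀ i, 0 < q t i) ∧ (∀ i, q t i ≤ 1) ∧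
      ∑ i, (q t i - p i) ^ 2 / (p i * q t i) ≤ t ^ 2 * ∑ i, w i ^ 2 / (p i * q t i)) (j : Fin n) :
    Tendsto (fun t => q t j) (𝓝[≠] (0:ℝ)) (𝓝 (p j)) := by
  -- constants
  set C := ∑ i, w i ^ 2 / p i ^ 2 with hC
  set S := ∑ i, 1 / p i with hS
  have hC0 : 0 ≤ C := Finset.sum_nonneg fun i _ => by positivity
  have hsmall : ∀ᶠ t in 𝓝[≠] (0:ℝ), t ^ 2 * C < 1 / 2 := by
    apply eventually_nhdsWithin_of_eventually_nhds
    have : Tendsto (fun t : ℝ => t ^ 2 * C) (𝓝 0) (𝓝 (0 ^ 2 * C)) :=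
      Continuous.tendsto (by fun_prop) 0
    apply this.eventually_lt_const
    norm_num
  have hb : ∀ᶠ t in 𝓝[≠] (0:ℝ), (q t j - p j) ^ 2 ≤ t ^ 2 * (C * (4 * n) * p j) := by
    filter_upwards [hq, hsmall] with t ⟨h0, h1, h2⟩ ht
    set R := ∑ i, p i / q t i with hR
    have hR0 : 0 ≤ R := Finset.sum_nonneg fun i _ => (div_pos (hp i) (h0 i)).le
    have e1 : ∑ i, w i ^ 2 / (p i * q t i) ≤ C * R := by
      rw [hR, Finset.mul_sum]
      apply Finset.sum_le_sum
      intro i _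
      have : w i ^ 2 / (p i * q t i) = w i ^ 2 / p i ^ 2 * (p i / q t i) := by
        have := (hp i).ne'; have := (h0 i).ne'
        field_simp
      rw [this]
      apply mul_le_mul_of_nonneg_right _ (div_pos (hp i) (h0 i)).le
      exact Finset.single_le_sum (f := fun i => w i ^ 2 / p i ^ 2)
        (fun i _ => by positivity) (Finset.mem_univ i)
    have e2 : R - 2 * n ≤ ∑ i, (q t i - p i) ^ 2 / (p i * q t i) := by
      have : R - 2 * n = ∑ i, (p i / q t i - 2) := by
        rw [Finset.sum_sub_distrib]; simp [hR]; ring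
      rw [this]
      apply Finset.sum_le_sum
      intro i _
      have e : (q t i - p i) ^ 2 / (p i * q t i) = p i / q t i - 2 + q t i / p i := by
        have := (hp i).ne'; have := (h0 i).ne'
        field_simp
        ring
      have := div_pos (h0 i) (hp i)
      linarith
    have e3 : t ^ 2 * ∑ i, w i ^ 2 / (p i * q t i) ≤ t ^ 2 * (C * R) :=
      mul_le_mul_of_nonneg_left e1 (sq_nonneg t)
    have e4 : R ≤ 4 * n := by nlinarith
    have e5 : (q t j - p j) ^ 2 / (p j * q t j) ≤ t ^ 2 * (C * (4 * n)) := by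
      calc _ ≤ ∑ i, (q t i - p i) ^ 2 / (p i * q t i) :=
            Finset.single_le_sum (f := fun i => (q t i - p i) ^ 2 / (p i * q t i))
              (fun i _ => by have := hp i; have := h0 i; positivity) (Finset.mem_univ j)
        _ ≤ _ := h2
        _ ≤ _ := e3
        _ ≤ _ := by gcongr
    rw [div_le_iff₀ (mul_pos (hp j) (h0 j))] at e5
    refine e5.trans ?_
    have : p j * q t j ≤ p j := mul_le_of_le_one_right (hp j).le (h1 j)
    calc _ ≤ t ^ 2 * (C * (4 * n)) * p j := by gcongr
      _ = _ := by ring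
  have hz : Tendsto (fun t => (q t j - p j) ^ 2) (𝓝[≠] (0:ℝ)) (𝓝 0) := by
    apply squeeze_zero' (Eventually.of_forall fun t => sq_nonneg _) hb
    have : Tendsto (fun t : ℝ => t ^ 2 * (C * (4 * n) * p j)) (𝓝 0)
      (𝓝 (0 ^ 2 * (C * (4 * n) * p j))) := Continuous.tendsto (by fun_prop) 0
    simp only [ne_eq, OfNat.ofNat_ne_zero, not_false_eq_true, zero_pow, zero_mul] at this
    exact this.mono_left nhdsWithin_le_nhds
  have hs := (Real.continuous_sqrt.tendsto 0).comp hz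
  simp only [Function.comp_def, Real.sqrt_sq_eq_abs, Real.sqrt_zero] at hs
  replace hs := (tendsto_zero_iff_abs_tendsto_zero _).2 hs
  simpa using hs.add_const (p j)

open Filter Topology in
lemma deriv_aux {n : ℕ} (p w : Fin n → ℝ) (q : ℝ → Fin n → ℝ) (hp : ∀ i, 0 < p i)
    (hq : ∀ᶠ t in 𝓝[≠] (0:ℝ), (∀ i, 0 < q t i) ∧ (∀ i, q t i ≤ 1) ∧
      ∑ i, (q t i - p i) ^ 2 / (p i * q t i) ≤ t ^ 2 * ∑ i, w i ^ 2 / (p i * q t i)) (k : Fin n)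
    (D : ℝ) (hq0 : q 0 = p) (hD : HasDerivAt (fun t => q t k) D 0) :
    D ^ 2 ≤ p k ^ 2 * ∑ i, w i ^ 2 / p i ^ 2 := by
  have hl := lim_aux p w q hp hq
  have h1 := (hasDerivAt_iff_tendsto_slope_zero.1 hD).pow 2
  simp only [zero_add, hq0, smul_eq_mul] at h1
  have h2 : Tendsto (fun t => p k * q t k * ∑ i, w i ^ 2 / (p i * q t i)) (𝓝[≠] (0:ℝ))
      (𝓝 (p k * p k * ∑ i, w i ^ 2 / (p i * p i))) := by
    apply ((hl k).const_mul (p k)).mul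
    apply tendsto_finsetSum
    intro i _
    apply Tendsto.div tendsto_const_nhds ((hl i).const_mul (p i))
    exact (mul_pos (hp i) (hp i)).ne'
  simp only [← pow_two] at h2
  apply le_of_tendsto_of_tendsto h1 h2
  filter_upwards [hq, self_mem_nhdsWithin] with t ⟨h0, _, h3⟩ ht
  have ht : t ≠ 0 := ht
  have e5 : (q t k - p k) ^ 2 / (p k * q t k) ≤ t ^ 2 * ∑ i, w i ^ 2 / (p i * q t i) :=
    le_trans (Finset.single_le_sum (f := fun i => (q t i - p i) ^ 2 / (p i * q t i))
              (fun i _ => by have := hp i; have := h0 i; positivity) (Finset.mem_univ k)) h3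
  rw [div_le_iff₀ (mul_pos (hp k) (h0 k))] at e5
  rw [mul_pow, inv_pow, inv_mul_le_iff₀ (by positivity)]
  linarith

/-- the bound on `w`. -/
lemma w_aux {n : ℕ} (p s s' : Fin n → ℝ) (hp : ∀ i, 0 < p i) (hs : ∀ i, 0 ≤ s i)
    (hs' : ∀ i, 0 ≤ s' i) (h : ∑ i, (s i + s' i - 2 * p i) / p i = 0) :
    ∑ i, (s i - p i) ^ 2 / p i ^ 2 ≤ n + 4 * (n:ℝ) ^ 2 := by
  have e1 : ∑ i, (s i + s' i - 2 * p i) / p i = ∑ i, s i / p i + ∑ i, s' i / p i - 2 * n := by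
    have : (2 * n : ℝ) = ∑ i : Fin n, 2 := by simp; ring
    rw [this, ← Finset.sum_add_distrib, ← Finset.sum_sub_distrib]
    apply Finset.sum_congr rfl
    intro i _
    have := (hp i).ne'
    field_simp
  have e2 : 0 ≤ ∑ i, s' i / p i := Finset.sum_nonneg fun i _ => div_nonneg (hs' i) (hp i).le
  have e3 : 0 ≤ ∑ i, s i / p i := Finset.sum_nonneg fun i _ => div_nonneg (hs i) (hp i).le
  have e4 : ∑ i, (s i / p i) ^ 2 ≤ (∑ i, s i / p i) ^ 2 :=
    Finset.sum_sq_le_sq_sum_of_nonneg fun i _ => div_nonneg (hs i) (hp i).le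
  have e5 : ∑ i, (s i - p i) ^ 2 / p i ^ 2 ≤ ∑ i, (s i / p i) ^ 2 + n := by
    have : (n : ℝ) = ∑ i : Fin n, 1 := by simp
    rw [this, ← Finset.sum_add_distrib]
    apply Finset.sum_le_sum
    intro i _
    have e : (s i - p i) ^ 2 / p i ^ 2 = (s i / p i) ^ 2 + 1 - 2 * (s i / p i) := by
      have := (hp i).ne'
      field_simp
      ring
    have := div_nonneg (hs i) (hp i).le
    linarith
  have e6 : (∑ i, s i / p i) ^ 2 ≤ (2 * n) ^ 2 := pow_le_pow_left₀ e3 (by linarith) 2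
  nlinarith

lemma hull_aux {d n : ℕ} (a : Fin n → EuclideanSpace ℝ (Fin d)) (y : EuclideanSpace ℝ (Fin d))
    (hy : y ∈ convexHull ℝ (Set.range a)) :
    ∃ s : Fin n → ℝ, (∀ i, 0 ≤ s i) ∧ ∑ i, s i = 1 ∧ ∑ i, s i • a i = y := by
  have hsub : convexHull ℝ (Set.range a) ⊆
      {y | ∃ s : Fin n → ℝ, (∀ i, 0 ≤ s i) ∧ ∑ i, s i = 1 ∧ ∑ i, s i • a i = y} := by
    apply convexHull_min
    · rintro _ ⟨j, rfl⟩
      refine ⟨fun i => if i = j then 1 else 0, fun i => ?_, by simp, by simp⟩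
      dsimp only
      split_ifs <;> norm_num
    · rintro _ ⟨s, h0, h1, rfl⟩ _ ⟨s', h0', h1', rfl⟩ b c hb hc hbc
      refine ⟨fun i => b * s i + c * s' i, fun i => ?_, ?_, ?_⟩
      · have := h0 i; have := h0' i; positivity
      · rw [Finset.sum_add_distrib, ← Finset.mul_sum, ← Finset.mul_sum, h1, h1']; simpa using hbc
      · simp only [add_smul, mul_smul, Finset.sum_add_distrib, Finset.smul_sum]
  exact hsub hy

lemma ray_aux {d : ℕ} (P : Set (EuclideanSpace ℝ (Fin d))) (hc : Convex ℝ P)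
    (x ξ : EuclideanSpace ℝ (Fin d)) (hx : x ∈ P) (r : ℝ) (hr : 0 < r)
    (h : r < rayDist P x ξ) : x + (r * ‖ξ‖⁻¹) • ξ ∈ P := by
  obtain ⟨t, ⟨_, ht⟩, hrt⟩ := exists_lt_of_lt_csSup ⟨0, by simpa using hx⟩ h
  have ht0 : 0 < t := hr.trans hrt
  have := hc.add_smul_mem hx ht (t := r / t) ⟨by positivity, by rw [div_le_one ht0]; exact hrt.le⟩
  rw [smul_smul] at this
  convert this using 3
  field_simp

open Filter Topology in
lemma ray_pos {d : ℕ} (P : Set (EuclideanSpace ℝ (Fin d))) (hb : Bornology.IsBounded P)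
    (x ξ : EuclideanSpace ℝ (Fin d)) (hx : x ∈ interior P) (hξ : ξ ≠ 0) : 0 < rayDist P x ξ := by
  have hn : 0 < ‖ξ‖ := norm_pos_iff.2 hξ
  have hbd : BddAbove {t : ℝ | 0 ≤ t ∧ x + (t * ‖ξ‖⁻¹) • ξ ∈ P} := by
    obtain ⟨R, hR⟩ := hb.exists_norm_le
    refine ⟨R + ‖x‖, ?_⟩
    rintro t ⟨ht, htP⟩
    have h1 := hR _ htP
    have h2 : ‖(t * ‖ξ‖⁻¹) • ξ‖ = t := by
      rw [norm_smul, Real.norm_of_nonneg (by positivity)]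
      field_simp
    have h3 := norm_sub_le (x + (t * ‖ξ‖⁻¹) • ξ) x
    rw [add_sub_cancel_left, h2] at h3
    linarith
  have hev : ∀ᶠ t : ℝ in 𝓝[>] 0, x + (t * ‖ξ‖⁻¹) • ξ ∈ P := by
    apply eventually_nhdsWithin_of_eventually_nhds
    have : Tendsto (fun t : ℝ => x + (t * ‖ξ‖⁻¹) • ξ) (𝓝 0) (𝓝 (x + ((0:ℝ) * ‖ξ‖⁻¹) • ξ)) :=
      Continuous.tendsto (by fun_prop) 0
    apply this
    simpa using mem_interior_iff_mem_nhds.1 hx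
  obtain ⟨t, ht, ht0⟩ := (hev.and self_mem_nhdsWithin).exists
  have ht0 : 0 < t := ht0
  exact ht0.trans_le (le_csSup hbd ⟨ht0.le, ht⟩)

open Filter Topology in
/-- `|p_{k(ξ)}(x)| / pₖ(x) ≤ (n+4n²)^{1/2} |ξ| / min(d(x,ξ), d(x,-ξ))`. -/
theorem stmt_16 {d n : ℕ} (hn : 2 ≤ n) (a : Fin n → EuclideanSpace ℝ (Fin d))
    (ha : Function.Injective a)
    (P : Set (EuclideanSpace ℝ (Fin d)))
    (hP : P = convexHull ℝ (Set.range a))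
    (hvert : ∀ i, a i ∈ Set.extremePoints ℝ P)
    (hint : (interior P).Nonempty)
    (p : EuclideanSpace ℝ (Fin d) → Fin n → ℝ)
    (hp : ∀ x ∈ interior P, (∀ i, 0 < p x i) ∧ ∑ i, p x i = 1 ∧
      ∑ i, p x i • a i = x ∧ ∑ i, Real.log (p x i) = entropyU a x) :
    ∀ x ∈ interior P, ∀ ξ : EuclideanSpace ℝ (Fin d), ξ ≠ 0 → ∀ k,
      |fderiv ℝ (fun y => p y k) x ξ| / p x k
        ≤ Real.sqrt ((n : ℝ) + 4 * (n : ℝ) ^ 2) * ‖ξ‖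
            / min (rayDist P x ξ) (rayDist P x (-ξ)) := by
  intro x hx ξ hξ k
  have hcv : Convex ℝ P := hP ▸ convex_convexHull ℝ _
  have hbd : Bornology.IsBounded P := by
    rw [hP]; exact isBounded_convexHull.2 (Set.finite_range a).isBounded
  have hxP : x ∈ P := interior_subset hx
  have hξ0 : 0 < ‖ξ‖ := norm_pos_iff.2 hξ
  set m := min (rayDist P x ξ) (rayDist P x (-ξ)) with hm
  have hm0 : 0 < m := lt_min (ray_pos P hbd x ξ hx hξ) (ray_pos P hbd x (-ξ) hx (neg_ne_zero.2 hξ))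
  obtain ⟨hp0, hp1, hp2, hp3⟩ := hp x hx
  by_cases hdiff : DifferentiableAt ℝ (fun y => p y k) x
  swap
  · rw [fderiv_zero_of_not_differentiableAt hdiff]
    simp only [ContinuousLinearMap.zero_apply, abs_zero, zero_div]
    positivity
  set D := fderiv ℝ (fun y => p y k) x ξ with hDdef
  have hD : HasDerivAt (fun t : ℝ => p (x + t • ξ) k) D 0 :=
    hdiff.hasFDerivAt.hasLineDerivAt ξ
  have main : ∀ r, 0 < r → r < m → r * |D| ≤ Real.sqrt ((n : ℝ) + 4 * (n : ℝ) ^ 2) * ‖ξ‖ * p x k := by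
    intro r hr hrm
    have hy := ray_aux P hcv x ξ hxP r hr (hrm.trans_le (min_le_left _ _))
    have hy' := ray_aux P hcv x (-ξ) hxP r hr (hrm.trans_le (min_le_right _ _))
    rw [norm_neg] at hy'
    set τ := r * ‖ξ‖⁻¹ with hτ
    have hτ0 : 0 < τ := by positivity
    rw [hP] at hy hy'
    obtain ⟨s, hs0, hs1, hs2⟩ := hull_aux a _ hy
    obtain ⟨s', hs0', hs1', hs2'⟩ := hull_aux a _ hy'
    have hw := w_aux (p x) s s' hp0 hs0 hs0' (by
      apply opt_aux a x (p x) hp0 hp1 hp2 hp3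
      · rw [Finset.sum_sub_distrib, Finset.sum_add_distrib, ← Finset.mul_sum, hs1, hs1', hp1]
        norm_num
      · simp only [sub_smul, add_smul, mul_smul]
        rw [Finset.sum_sub_distrib, Finset.sum_add_distrib, ← Finset.smul_sum, hs2, hs2', hp2]
        module)
    have hw1 : ∑ i, τ⁻¹ * (s i - p x i) = 0 := by
      rw [← Finset.mul_sum, Finset.sum_sub_distrib, hs1, hp1]; simp
    have hw2 : ∑ i, (τ⁻¹ * (s i - p x i)) • a i = ξ := by
      simp only [mul_smul, sub_smul]
      rw [← Finset.smul_sum, Finset.sum_sub_distrib, hs2, hp2, add_sub_cancel_left, smul_smul,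
        inv_mul_cancel₀ hτ0.ne', one_smul]
    have hder := deriv_aux (p x) (fun i => τ⁻¹ * (s i - p x i)) (fun t => p (x + t • ξ)) hp0 (by
      apply eventually_nhdsWithin_of_eventually_nhds
      have hev : ∀ᶠ t : ℝ in 𝓝 0, x + t • ξ ∈ interior P := by
        have : Tendsto (fun t : ℝ => x + t • ξ) (𝓝 0) (𝓝 (x + (0:ℝ) • ξ)) :=
          Continuous.tendsto (by fun_prop) 0
        apply this
        simpa using isOpen_interior.mem_nhds hx
      filter_upwards [hev] with t ht
      obtain ⟨hq0, hq1, hq2, hq3⟩ := hp _ ht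
      have hk1 : ∑ i, (p (x + t • ξ) i - p x i - t * (τ⁻¹ * (s i - p x i))) = 0 := by
        rw [Finset.sum_sub_distrib, Finset.sum_sub_distrib, ← Finset.mul_sum, hw1, hq1, hp1]
        simp
      have hk2 : ∑ i, (p (x + t • ξ) i - p x i - t * (τ⁻¹ * (s i - p x i))) • a i = 0 := by
        simp only [sub_smul _ _ (a _), mul_smul t]
        rw [Finset.sum_sub_distrib, Finset.sum_sub_distrib, ← Finset.smul_sum, hq2, hp2]
        rw [hw2]
        simp
      refine ⟨hq0, fun i => ?_, ?_⟩
      · rw [← hq1]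
        exact Finset.single_le_sum (fun j _ => (hq0 j).le) (Finset.mem_univ i)
      · apply diff_aux _ _ _ _ hp0 hq0
        · exact opt_aux a x _ hp0 hp1 hp2 hp3 _ hk1 hk2
        · exact opt_aux a _ _ hq0 hq1 hq2 hq3 _ hk1 hk2) k D (by simp) hD
    have hA : ∑ i, (τ⁻¹ * (s i - p x i)) ^ 2 / p x i ^ 2
        = (τ⁻¹) ^ 2 * ∑ i, (s i - p x i) ^ 2 / p x i ^ 2 := by
      rw [Finset.mul_sum]
      apply Finset.sum_congr rfl
      intro i _
      ring
    rw [hA] at hder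
    have hsq : (r * |D|) ^ 2 ≤ (Real.sqrt ((n : ℝ) + 4 * (n : ℝ) ^ 2) * ‖ξ‖ * p x k) ^ 2 := by
      rw [mul_pow, mul_pow, mul_pow, Real.sq_sqrt (by positivity), sq_abs]
      calc r ^ 2 * D ^ 2 ≤ r ^ 2 * (p x k ^ 2 * (τ⁻¹ ^ 2 * (n + 4 * (n:ℝ) ^ 2))) := by
            refine mul_le_mul_of_nonneg_left (hder.trans ?_) (sq_nonneg r)
            gcongr
        _ = _ := by
            rw [hτ]; field_simp
    have := hp0 k
    exact le_of_sq_le_sq hsq (by positivity)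
  have hfin : m * |D| ≤ Real.sqrt ((n : ℝ) + 4 * (n : ℝ) ^ 2) * ‖ξ‖ * p x k := by
    have ht : Tendsto (fun r : ℝ => r * |D|) (𝓝[<] m) (𝓝 (m * |D|)) :=
      (Continuous.tendsto (by fun_prop) m).mono_left nhdsWithin_le_nhds
    apply le_of_tendsto ht
    filter_upwards [Ioo_mem_nhdsLT hm0] with r hr
    exact main r hr.1 hr.2
  rw [div_le_div_iff₀ (hp0 k) hm0]
  linarith
end

section
/- For the entropy-maximizing weights $p_k$ on the interior of a polytope with vertices $a_1,\dots,a_n$: if $\xi = \sum_k q_k (a_k - x)$ with $\sum_k q_k = 0$, then $\sum_k q_k^2 / p_k(x)^2 = \sum_k (p_{k(\xi)}(x))^2 / p_k(x)^2 + \sum_k (p_{k(\xi)}(x) - q_k)^2 / p_k(x)^2$. -/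
open Finset

lemma aux_lagrange {V : Type*} [NormedAddCommGroup V] [NormedSpace ℝ V] [FiniteDimensional ℝ V]
    {n : ℕ} (b : Fin n → V) (p : Fin n → ℝ) (hp : ∀ i, 0 < p i)
    (hmax : ∀ r : Fin n → ℝ, (∀ i, 0 < r i) → ∑ i, r i • b i = ∑ i, p i • b i →
      ∑ i, Real.log (r i) ≤ ∑ i, Real.log (p i)) :
    ∃ ψ : V →L[ℝ] ℝ, ∀ k, ψ (b k) = (p k)⁻¹ := by
  classical
  let T : (Fin n → ℝ) →ₗ[ℝ] V := Fintype.linearCombination ℝ b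
  let φ : (Fin n → ℝ) →ₗ[ℝ] ℝ := Fintype.linearCombination ℝ (fun k => (p k)⁻¹)
  have key : φ ∈ (LinearMap.ker T).dualAnnihilator := by
    rw [Submodule.mem_dualAnnihilator]
    intro c hc
    have hc' : ∑ i, c i • b i = 0 := by
      simpa [T, Fintype.linearCombination_apply] using hc
    have hd : HasDerivAt (fun t : ℝ => ∑ i, Real.log (p i + t * c i))
        (∑ i, c i / p i) 0 := by
      have : ∀ i ∈ (Finset.univ : Finset (Fin n)),
          HasDerivAt (fun t : ℝ => Real.log (p i + t * c i)) (c i / p i) 0 := by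
        intro i _
        have h1 : HasDerivAt (fun t : ℝ => p i + t * c i) (c i) 0 := by
          simpa using ((hasDerivAt_id (0:ℝ)).mul_const (c i)).const_add (p i)
        simpa using h1.log (by simpa using (hp i).ne')
      exact HasDerivAt.fun_sum this
    have hev : ∀ᶠ t : ℝ in nhds 0, ∀ i, 0 < p i + t * c i := by
      rw [Filter.eventually_all]
      intro i
      have : ContinuousAt (fun t : ℝ => p i + t * c i) 0 := by fun_prop
      exact this.eventually (lt_mem_nhds (by simpa using hp i))
    have hloc : IsLocalMax (fun t : ℝ => ∑ i, Real.log (p i + t * c i)) 0 := by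
      filter_upwards [hev] with t ht
      have := hmax _ ht (by
        simp only [add_smul, Finset.sum_add_distrib, mul_smul, ← Finset.smul_sum, hc']
        simp)
      simpa using this
    have := hloc.hasDerivAt_eq_zero hd
    simpa [φ, Fintype.linearCombination_apply, div_eq_mul_inv] using this
  rw [← LinearMap.range_dualMap_eq_dualAnnihilator_ker] at key
  obtain ⟨ψ, hψ⟩ := key
  refine ⟨LinearMap.toContinuousLinearMap ψ, fun k => ?_⟩
  have := LinearMap.congr_fun hψ (Pi.single k 1)
  simpa [T, φ, Fintype.linearCombination_apply_single] using this

lemma aux_unique {V : Type*} [NormedAddCommGroup V] [NormedSpace ℝ V]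
    {n : ℕ} (b : Fin n → V) (r s : Fin n → ℝ) (hr : ∀ i, 0 < r i) (hs : ∀ i, 0 < s i)
    (ψ : V →L[ℝ] ℝ) (hψ : ∀ k, ψ (b k) = (r k)⁻¹)
    (hsum : ∑ i, s i • b i = ∑ i, r i • b i)
    (hle : ∑ i, Real.log (r i) ≤ ∑ i, Real.log (s i)) : s = r := by
  have h1 : ∑ i, (s i / r i - 1) = 0 := by
    have := congrArg ψ hsum
    simp only [map_sum, map_smul, hψ, smul_eq_mul] at this
    have h2 : ∀ i, r i * (r i)⁻¹ = 1 := fun i => mul_inv_cancel₀ (hr i).ne'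
    simp only [h2] at this
    simp only [Finset.sum_sub_distrib, div_eq_mul_inv, this, sub_self]
  by_contra hne
  obtain ⟨j, hj⟩ := Function.ne_iff.mp hne
  have hlt : ∑ i, (Real.log (s i) - Real.log (r i)) < ∑ i, (s i / r i - 1) := by
    apply Finset.sum_lt_sum
    · intro i _
      rw [← Real.log_div (hs i).ne' (hr i).ne']
      exact Real.log_le_sub_one_of_pos (div_pos (hs i) (hr i))
    · refine ⟨j, Finset.mem_univ _, ?_⟩
      rw [← Real.log_div (hs j).ne' (hr j).ne']
      refine Real.log_lt_sub_one_of_pos (div_pos (hs j) (hr j)) ?_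
      intro h
      exact hj ((div_eq_one_iff_eq (hr j).ne').mp h)
  rw [h1, Finset.sum_sub_distrib] at hlt
  linarith

lemma aux_inverse {V : Type*} [NormedAddCommGroup V] [NormedSpace ℝ V] [FiniteDimensional ℝ V]
    {n : ℕ} (b : Fin n → V) (hb : ∀ v : V →L[ℝ] ℝ, (∀ k, v (b k) = 0) → v = 0)
    (p : Fin n → ℝ) (hp : ∀ i, 0 < p i) (ψ : V →L[ℝ] ℝ) (hψ : ∀ k, ψ (b k) = (p k)⁻¹) :
    ∃ (g : V → (V →L[ℝ] ℝ)) (g' : V →L[ℝ] (V →L[ℝ] ℝ)),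
      g (∑ i, p i • b i) = ψ ∧ HasFDerivAt g g' (∑ i, p i • b i) ∧
      (∀ᶠ y in nhds (∑ i, p i • b i), ∑ i, (g y (b i))⁻¹ • b i = y) ∧
      ∀ y, ∑ i, (-(p i) ^ 2 * g' y (b i)) • b i = y := by
  let F : (V →L[ℝ] ℝ) → V := fun w => ∑ i, (w (b i))⁻¹ • b i
  let F' : (V →L[ℝ] ℝ) →L[ℝ] V :=
    ∑ i, ((-(p i) ^ 2) • ContinuousLinearMap.apply ℝ ℝ (b i)).smulRight (b i)
  have hF' : ∀ w, F' w = ∑ i, (-(p i) ^ 2 * w (b i)) • b i := by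
    intro w; simp [F']
  have hF : HasStrictFDerivAt F F' ψ := by
    refine HasStrictFDerivAt.fun_sum fun i _ => ?_
    refine HasStrictFDerivAt.smul_const ?_ _
    have h1 : HasStrictFDerivAt (fun w : V →L[ℝ] ℝ => w (b i))
      (ContinuousLinearMap.apply ℝ ℝ (b i)) ψ :=
      (ContinuousLinearMap.apply ℝ ℝ (b i)).hasStrictFDerivAt
    have h2 := (hasStrictDerivAt_inv (x := ψ (b i)) (by rw [hψ]; exact (inv_pos.2 (hp i)).ne'))
    have h3 := h2.comp_hasStrictFDerivAt ψ h1
    have h4 : (-(p i) ^ 2) • ContinuousLinearMap.apply ℝ ℝ (b i)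
        = -(ψ (b i) ^ 2)⁻¹ • ContinuousLinearMap.apply ℝ ℝ (b i) := by
      rw [hψ]; simp
    rw [h4]; exact h3
  have hinj : Function.Injective F' := by
    rw [injective_iff_map_eq_zero]
    intro v hv
    apply hb
    have h1 : ∑ i, (p i * v (b i)) ^ 2 = 0 := by
      have := congrArg v hv
      rw [hF'] at this
      simp only [map_sum, map_smul, smul_eq_mul, map_zero] at this
      rw [← neg_eq_zero, ← this, ← Finset.sum_neg_distrib]
      exact Finset.sum_congr rfl fun i _ => by ring
    rw [Finset.sum_eq_zero_iff_of_nonneg (fun i _ => sq_nonneg _)] at h1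
    intro k
    have := h1 k (Finset.mem_univ _)
    simpa [(hp k).ne'] using this
  have hrank : Module.finrank ℝ (V →L[ℝ] ℝ) = Module.finrank ℝ V := by
    rw [← (LinearMap.toContinuousLinearMap (𝕜 := ℝ) (E := V) (F' := ℝ)).finrank_eq]
    exact Subspace.dual_finrank_eq
  let e : (V →L[ℝ] ℝ) ≃L[ℝ] V :=
    (LinearEquiv.ofInjectiveOfFinrankEq F'.toLinearMap hinj hrank).toContinuousLinearEquiv
  have he : (e : (V →L[ℝ] ℝ) →L[ℝ] V) = F' := by
    ext w; rfl
  rw [← he] at hF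
  have hFψ : F ψ = ∑ i, p i • b i := by simp [F, hψ]
  refine ⟨hF.localInverse F e ψ, e.symm, ?_, ?_, ?_, ?_⟩
  · rw [← hFψ]; exact hF.localInverse_apply_image
  · rw [← hFψ]; exact hF.to_localInverse.hasFDerivAt
  · rw [← hFψ]; exact hF.eventually_right_inverse
  · intro y
    have := hF' (e.symm y)
    rw [← he] at this
    simpa using this.symm

/-- If `ξ = ∑ₖ qₖ (aₖ - x)` with `∑ₖ qₖ = 0`, then
`∑ₖ qₖ²/pₖ² = ∑ₖ (p_{k(ξ)})²/pₖ² + ∑ₖ (p_{k(ξ)} - qₖ)²/pₖ²`. -/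
theorem stmt_19 {d n : ℕ} (hn : 2 ≤ n) (a : Fin n → EuclideanSpace ℝ (Fin d))
    (ha : Function.Injective a)
    (P : Set (EuclideanSpace ℝ (Fin d)))
    (hP : P = convexHull ℝ (Set.range a))
    (hvert : ∀ i, a i ∈ Set.extremePoints ℝ P)
    (hint : (interior P).Nonempty)
    (p : EuclideanSpace ℝ (Fin d) → Fin n → ℝ)
    (hp : ∀ x ∈ interior P, (∀ i, 0 < p x i) ∧ ∑ i, p x i = 1 ∧
      ∑ i, p x i • a i = x ∧ ∑ i, Real.log (p x i) = entropyU a x) :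
    ∀ x ∈ interior P, ∀ q : Fin n → ℝ, ∀ ξ : EuclideanSpace ℝ (Fin d),
      ξ = ∑ k, q k • (a k - x) → ∑ k, q k = 0 →
      ∑ k, (q k) ^ 2 / (p x k) ^ 2
        = ∑ k, (fderiv ℝ (fun y => p y k) x ξ) ^ 2 / (p x k) ^ 2
          + ∑ k, (fderiv ℝ (fun y => p y k) x ξ - q k) ^ 2 / (p x k) ^ 2 := by
  intro x hx q ξ hξ hq
  let b : Fin n → ℝ × EuclideanSpace ℝ (Fin d) := fun i => (1, a i)
  have hsumb : ∀ r : Fin n → ℝ, ∑ i, r i • b i = (∑ i, r i, ∑ i, r i • a i) := by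
    intro r
    ext1 <;> simp [b, Prod.fst_sum, Prod.snd_sum]
  have hpb : ∀ y ∈ interior P, ∑ i, p y i • b i = (1, y) := by
    intro y hy
    rw [hsumb, (hp y hy).2.1, (hp y hy).2.2.1]
  have hmax : ∀ y ∈ interior P, ∀ r : Fin n → ℝ, (∀ i, 0 < r i) →
      ∑ i, r i • b i = ∑ i, p y i • b i →
      ∑ i, Real.log (r i) ≤ ∑ i, Real.log (p y i) := by
    intro y hy r hr hrb
    rw [hpb y hy, hsumb, Prod.mk.injEq] at hrb
    rw [(hp y hy).2.2.2]
    refine le_csSup ⟨0, ?_⟩ ⟨r, hr, hrb.1, hrb.2, rfl⟩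
    rintro s ⟨t, ht, ht1, -, rfl⟩
    refine Finset.sum_nonpos fun i _ => Real.log_nonpos (ht i).le ?_
    rw [← ht1]
    exact Finset.single_le_sum (fun j _ => (ht j).le) (Finset.mem_univ i)
  have hb : ∀ v : (ℝ × EuclideanSpace ℝ (Fin d)) →L[ℝ] ℝ, (∀ k, v (b k) = 0) → v = 0 := by
    intro v hv
    have hv0 : ∀ y ∈ interior P, v (1, y) = 0 := by
      intro y hy
      rw [← hpb y hy]
      simp [map_sum, hv]
    have h2 : ∀ z, v (0, z) = 0 := by
      intro z
      have hc : ContinuousAt (fun t : ℝ => x + t • z) 0 := by fun_prop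
      have hev : ∀ᶠ t : ℝ in nhds 0, x + t • z ∈ interior P :=
        hc.eventually (by simpa using isOpen_interior.mem_nhds hx)
      have hev' : ∀ᶠ t : ℝ in nhdsWithin 0 {0}ᶜ, x + t • z ∈ interior P ∧ t ≠ 0 :=
        (hev.filter_mono nhdsWithin_le_nhds).and self_mem_nhdsWithin
      obtain ⟨t, ht, ht0⟩ := hev'.exists
      have h3 := hv0 _ ht
      have h4 : ((1 : ℝ), x + t • z) = (1, x) + t • ((0 : ℝ), z) := by simp
      rw [h4, map_add, map_smul, hv0 x hx] at h3
      simpa [ht0] using h3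
    refine ContinuousLinearMap.ext fun w => ?_
    have h5 : w = w.1 • ((1 : ℝ), x) + ((0 : ℝ), w.2 - w.1 • x) := by
      ext1 <;> simp
    rw [h5, map_add, map_smul, hv0 x hx, h2]
    simp
  have hpx := (hp x hx).1
  obtain ⟨ψ, hψ⟩ := aux_lagrange b (p x) hpx (hmax x hx)
  obtain ⟨g, g', hg0, hg, hinv, hg'⟩ := aux_inverse b hb (p x) hpx ψ hψ
  rw [hpb x hx] at hg0 hg hinv
  have hι : HasFDerivAt (fun y : EuclideanSpace ℝ (Fin d) => ((1 : ℝ), y))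
      (ContinuousLinearMap.inr ℝ ℝ (EuclideanSpace ℝ (Fin d))) x :=
    hasFDerivAt_prodMk_right 1 x
  have hcomp : HasFDerivAt (fun y : EuclideanSpace ℝ (Fin d) => g (1, y))
      (g'.comp (ContinuousLinearMap.inr ℝ ℝ (EuclideanSpace ℝ (Fin d)))) x :=
    HasFDerivAt.comp (g := g) x hg hι
  have hk : ∀ k, HasFDerivAt (fun y : EuclideanSpace ℝ (Fin d) => g (1, y) (b k))
      ((ContinuousLinearMap.apply ℝ ℝ (b k)).comp
        (g'.comp (ContinuousLinearMap.inr ℝ ℝ (EuclideanSpace ℝ (Fin d))))) x := fun k =>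
    (ContinuousLinearMap.apply ℝ ℝ (b k)).hasFDerivAt.comp x hcomp
  have hpos : ∀ᶠ y in nhds x, ∀ k, 0 < g (1, y) (b k) := by
    rw [Filter.eventually_all]
    intro k
    refine (hk k).continuousAt.eventually (lt_mem_nhds ?_)
    change 0 < g (1, x) (b k)
    rw [hg0, hψ]
    exact inv_pos.2 (hpx k)
  have heq : ∀ᶠ y in nhds x, p y = fun k => (g (1, y) (b k))⁻¹ := by
    filter_upwards [hpos, hι.continuousAt.eventually hinv, isOpen_interior.mem_nhds hx]
      with y hy1 hy2 hy3
    have hs : ∑ i, (g (1, y) (b i))⁻¹ • b i = ∑ i, p y i • b i := by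
      rw [hy2, hpb y hy3]
    exact aux_unique b _ _ (fun i => inv_pos.2 (hy1 i)) (hp y hy3).1 (g (1, y))
      (fun k => by simp) hs.symm (hmax y hy3 _ (fun i => inv_pos.2 (hy1 i)) hs)
  have hD : ∀ k, fderiv ℝ (fun y => p y k) x ξ = -(p x k) ^ 2 * g' (0, ξ) (b k) := by
    intro k
    have h0 : g (1, x) (b k) ≠ 0 := by
      rw [hg0, hψ]; exact (inv_pos.2 (hpx k)).ne'
    have h1 := (hasDerivAt_inv h0).comp_hasFDerivAt x (hk k)
    have h2 : (fun y => p y k) =ᶠ[nhds x] (fun z => z⁻¹) ∘ fun y => g (1, y) (b k) := by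
      filter_upwards [heq] with y hy
      rw [hy]; rfl
    rw [(h1.congr_of_eventuallyEq h2).fderiv, hg0, hψ]
    simp
  have hsum := hg' (0, ξ)
  simp only [← hD] at hsum
  have hqb : ∑ i, q i • b i = (0, ξ) := by
    rw [hsumb, hq, hξ]
    simp [smul_sub, Finset.sum_sub_distrib, ← Finset.sum_smul, hq]
  have hcross : ∑ k, (fderiv ℝ (fun y => p y k) x ξ - q k) * g' (0, ξ) (b k) = 0 := by
    have h1 := congrArg (g' (0, ξ)) (hsum.trans hqb.symm)
    simp only [map_sum, map_smul, smul_eq_mul] at h1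
    simp only [sub_mul, Finset.sum_sub_distrib, h1, sub_self]
  have hfin : ∀ k, (q k) ^ 2 / (p x k) ^ 2
      = (fderiv ℝ (fun y => p y k) x ξ) ^ 2 / (p x k) ^ 2
        + (fderiv ℝ (fun y => p y k) x ξ - q k) ^ 2 / (p x k) ^ 2
        + 2 * ((fderiv ℝ (fun y => p y k) x ξ - q k) * g' (0, ξ) (b k)) := by
    intro k
    have h0 := (hpx k).ne'
    have h1 : g' (0, ξ) (b k) = - fderiv ℝ (fun y => p y k) x ξ / (p x k) ^ 2 := by
      rw [hD]; field_simp
    rw [h1]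
    field_simp
    ring
  rw [Finset.sum_congr rfl fun k _ => hfin k, Finset.sum_add_distrib, Finset.sum_add_distrib,
    ← Finset.mul_sum, hcross]
  ring
end
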